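/- arXiv:1807.10529 — 13 statements merged into one kernel-verified Lean document; each statement's English description precedes it below -/
import Mathlib

section
/- Assume (ϑ1) and (ϑ2). Then for all s ∈ ℝ one has |f(s)|/2 ≤ f'(s)|s| ≤ |f(s)|. -/
open Filter Topology Set

/-- Bounds for a function solving `f' = ϑ(f)^(-1/2)`, `f 0 = 0`, at positive arguments. -/
theorem bounds_of_pos {ϑ f : ℝ → ℝ} (hϑ_pos : ∀ s, 0 < ϑ s) (hf_zero : f 0 = 0)
    (hf_mono : StrictMono f) (hf_deriv : ∀ s, HasDerivAt f (1 / Real.sqrt (ϑ (f s))) s)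
    (hϑ_inc : MonotoneOn ϑ (Set.Ioi 0))
    (hϑ_div : AntitoneOn (fun s => ϑ s / s ^ 2) (Set.Ioi 0)) {s : ℝ} (hs : 0 < s) :
    f s / 2 ≤ 1 / √(ϑ (f s)) * s ∧ 1 / √(ϑ (f s)) * s ≤ f s := by
  have hf_pos : ∀ {c}, 0 < c → 0 < f c := fun hc => hf_zero ▸ hf_mono hc
  have hsqrt_pos : ∀ c, 0 < √(ϑ (f c)) := fun c => Real.sqrt_pos.2 (hϑ_pos _)
  have hf_cont : Continuous f :=
    continuous_iff_continuousAt.2 fun x => (hf_deriv x).continuousAt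
  constructor
  · obtain ⟨c, ⟨hc0, hcs⟩, hc⟩ := exists_hasDerivAt_eq_slope (fun x => f x ^ 2) _ hs
      (hf_cont.pow 2).continuousOn (fun x _ => (hf_deriv x).pow 2)
    have hdiv : ϑ (f s) / f s ^ 2 ≤ ϑ (f c) / f c ^ 2 :=
      hϑ_div (hf_pos hc0) (hf_pos hs) (hf_mono hcs).le
    have hfc := hf_pos hc0
    have hfs := hf_pos hs
    have hquot : f c / √(ϑ (f c)) ≤ f s / √(ϑ (f s)) := by
      rw [div_le_div_iff₀ (hsqrt_pos c) (hsqrt_pos s)]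
      rw [div_le_div_iff₀ (by positivity) (by positivity)] at hdiv
      refine le_of_sq_le_sq ?_ (mul_nonneg hfs.le (hsqrt_pos c).le)
      rw [mul_pow, mul_pow, Real.sq_sqrt (hϑ_pos _).le, Real.sq_sqrt (hϑ_pos _).le]
      linarith
    have hsq : f s ^ 2 = 2 * (f c / √(ϑ (f c))) * s := by
      rw [hf_zero, eq_div_iff (by linarith)] at hc
      norm_num at hc
      rw [← hc]
      ring
    have hle : f s * f s ≤ f s * (2 * (1 / √(ϑ (f s)) * s)) := by
      calc f s * f s = 2 * (f c / √(ϑ (f c))) * s := by rw [← hsq, sq]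
        _ ≤ 2 * (f s / √(ϑ (f s))) * s := by gcongr
        _ = _ := by ring
    linarith [le_of_mul_le_mul_left hle hfs]
  · obtain ⟨c, ⟨hc0, hcs⟩, hc⟩ := exists_hasDerivAt_eq_slope f _ hs
      hf_cont.continuousOn (fun x _ => hf_deriv x)
    rw [hf_zero, eq_div_iff (by linarith), sub_zero, sub_zero] at hc
    refine le_of_le_of_eq ?_ hc
    have hle : ϑ (f c) ≤ ϑ (f s) := hϑ_inc (hf_pos hc0) (hf_pos hs) (hf_mono hcs).le
    have := hsqrt_pos c
    gcongr

/-- Under (ϑ1)-(ϑ2), |f(s)|/2 ≤ f'(s)|s| ≤ |f(s)| for all s ∈ ℝ. -/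
theorem stmt_4
    (ϑ f : ℝ → ℝ)
    (hϑ_even : ∀ s, ϑ (-s) = ϑ s)
    (hϑ_C1 : ContDiff ℝ 1 ϑ)
    (hϑ_ge1 : ∀ s, 1 ≤ ϑ s)
    (hf_odd : ∀ s, f (-s) = - f s)
    (hf_zero : f 0 = 0)
    (hf_C2 : ContDiff ℝ 2 f)
    (hf_mono : StrictMono f)
    (hf_surj : Function.Surjective f)
    (hf_deriv : ∀ s, HasDerivAt f (1 / Real.sqrt (ϑ (f s))) s)
    (hϑ1_dec : StrictAntiOn ϑ (Set.Iio 0))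
    (hϑ1_inc : StrictMonoOn ϑ (Set.Ioi 0))
    (hϑ2_neg : MonotoneOn (fun s => ϑ s / s ^ 2) (Set.Iio 0))
    (hϑ2_pos : AntitoneOn (fun s => ϑ s / s ^ 2) (Set.Ioi 0)) :
    ∀ s : ℝ, |f s| / 2 ≤ deriv f s * |s| ∧ deriv f s * |s| ≤ |f s| := by
  have hpos : ∀ {s : ℝ}, 0 < s → _ := bounds_of_pos (fun s => one_pos.trans_le (hϑ_ge1 s))
    hf_zero hf_mono hf_deriv hϑ1_inc.monotoneOn hϑ2_pos
  intro s
  rw [(hf_deriv s).deriv]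
  rcases lt_trichotomy s 0 with hs | rfl | hs
  · have hfs : f s < 0 := hf_zero ▸ hf_mono hs
    have h := hpos (neg_pos.2 hs)
    rwa [hf_odd, hϑ_even, ← abs_of_neg hs, ← abs_of_neg hfs] at h
  · simp [hf_zero]
  · have hfs : 0 < f s := hf_zero ▸ hf_mono hs
    rw [abs_of_pos hs, abs_of_pos hfs]
    exact hpos hs
end

section
/- Assume (ϑ1) and (ϑ2). Then the map s ↦ |f(s)|/√|s| is nonincreasing on (-∞, 0) and nondecreasing on (0, ∞); equivalently, s ↦ f(s)/√s is nondecreasing on (0, ∞). -/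
open Filter Topology Set

/-- A function on `[0, ∞)` that is convex and vanishes at `0` has nondecreasing `s ↦ F s / s`. -/
theorem ConvexOn.monotoneOn_div_self {F : ℝ → ℝ} (hF : ConvexOn ℝ (Ici 0) F) (h0 : F 0 = 0) :
    MonotoneOn (fun s => F s / s) (Ioi 0) := by
  intro a (ha : 0 < a) b (hb : 0 < b) hab
  have h := hF.secant_mono (a := 0) self_mem_Ici ha.le hb.le ha.ne' hb.ne' hab
  simpa [h0] using h

/-- If `f` solves `f' = θ(f)^{-1/2}` and `θ(s)/s²` is nonincreasing on `(0, ∞)`, then `f²` is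
convex on `[0, ∞)`. -/
theorem convexOn_sq_of_antitoneOn_div_sq {θ f : ℝ → ℝ} (hθ : ∀ s, 0 < θ s) (hf0 : f 0 = 0)
    (hf : StrictMono f) (hf' : ∀ s, HasDerivAt f (1 / √(θ (f s))) s)
    (hθ' : AntitoneOn (fun s => θ s / s ^ 2) (Ioi 0)) :
    ConvexOn ℝ (Ici 0) (fun s => f s ^ 2) := by
  have hd : ∀ s, HasDerivAt (fun s => f s ^ 2) (2 * (f s / √(θ (f s)))) s := fun s => by
    refine ((hf' s).pow 2).congr_deriv ?_
    simp only [Nat.cast_ofNat, Nat.add_one_sub_one, pow_one]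
    ring
  refine MonotoneOn.convexOn_of_deriv (convex_Ici 0)
    (fun s _ => (hd s).continuousAt.continuousWithinAt)
    (fun s _ => (hd s).differentiableAt.differentiableWithinAt) ?_
  rw [interior_Ici]
  intro a (ha : 0 < a) b (hb : 0 < b) hab
  rw [(hd a).deriv, (hd b).deriv]
  have hfa : 0 < f a := hf0 ▸ hf ha
  have hfb : 0 < f b := hf0 ▸ hf hb
  have h := hθ' hfa hfb (hf.monotone hab)
  simp only at h
  rw [div_le_div_iff₀ (by positivity) (by positivity)] at h
  have hsa := Real.sqrt_pos.2 (hθ (f a))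
  have hsb := Real.sqrt_pos.2 (hθ (f b))
  gcongr 2 * ?_
  rw [div_le_div_iff₀ hsa hsb]
  refine le_of_sq_le_sq ?_ (by positivity)
  rw [mul_pow, mul_pow, Real.sq_sqrt (hθ _).le, Real.sq_sqrt (hθ _).le]
  linarith

/-- Under (ϑ1)-(ϑ2), s ↦ |f(s)|/√|s| is nonincreasing on (-∞,0) and nondecreasing on (0,∞); equivalently s ↦ f(s)/√s is nondecreasing on (0,∞). -/
theorem stmt_5
    (ϑ f : ℝ → ℝ)
    (hϑ_even : ∀ s, ϑ (-s) = ϑ s)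
    (hϑ_C1 : ContDiff ℝ 1 ϑ)
    (hϑ_ge1 : ∀ s, 1 ≤ ϑ s)
    (hf_odd : ∀ s, f (-s) = - f s)
    (hf_zero : f 0 = 0)
    (hf_C2 : ContDiff ℝ 2 f)
    (hf_mono : StrictMono f)
    (hf_surj : Function.Surjective f)
    (hf_deriv : ∀ s, HasDerivAt f (1 / Real.sqrt (ϑ (f s))) s)
    (hϑ1_dec : StrictAntiOn ϑ (Set.Iio 0))
    (hϑ1_inc : StrictMonoOn ϑ (Set.Ioi 0))
    (hϑ2_neg : MonotoneOn (fun s => ϑ s / s ^ 2) (Set.Iio 0))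
    (hϑ2_pos : AntitoneOn (fun s => ϑ s / s ^ 2) (Set.Ioi 0)) :
    AntitoneOn (fun s => |f s| / Real.sqrt |s|) (Set.Iio 0) ∧
    MonotoneOn (fun s => |f s| / Real.sqrt |s|) (Set.Ioi 0) ∧
    MonotoneOn (fun s => f s / Real.sqrt s) (Set.Ioi 0) := by
  have hpos : ∀ s, 0 < s → 0 < f s := fun s hs => hf_zero ▸ hf_mono hs
  have hmono : MonotoneOn (fun s => f s / Real.sqrt s) (Set.Ioi 0) := by
    intro a (ha : 0 < a) b (hb : 0 < b) hab
    have h := (convexOn_sq_of_antitoneOn_div_sq (fun s => one_pos.trans_le (hϑ_ge1 s)) hf_zero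
      hf_mono hf_deriv hϑ2_pos).monotoneOn_div_self (by simp [hf_zero]) ha hb hab
    simpa [Real.sqrt_div (sq_nonneg _), Real.sqrt_sq (hpos a ha).le,
      Real.sqrt_sq (hpos b hb).le] using Real.sqrt_le_sqrt h
  have habs : MonotoneOn (fun s => |f s| / Real.sqrt |s|) (Set.Ioi 0) :=
    hmono.congr fun s (hs : 0 < s) => by
      simp only [abs_of_pos hs, abs_of_pos (hpos s hs)]
  refine ⟨fun a (ha : a < 0) b (hb : b < 0) hab => ?_, habs, hmono⟩
  simpa [hf_odd] using habs (neg_pos.2 hb) (neg_pos.2 ha) (neg_le_neg hab)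
end

section
/- Assume (ϑ1), (ϑ2) and (ϑ3). Then lim_{s→∞} f(s)/√s = (8/α²)^{1/4}, and more generally lim_{|s|→∞} |f(s)|/√|s| = (8/α²)^{1/4}. -/
open Filter Topology Set

theorem tendsto_div_id_of_tendsto_deriv {g g' : ℝ → ℝ} {L : ℝ}
    (hg : ∀ x, HasDerivAt g (g' x) x) (hL : Tendsto g' atTop (𝓝 L)) :
    Tendsto (fun x => g x / x) atTop (𝓝 L) := by
  rw [Metric.tendsto_atTop] at hL ⊢
  intro ε hε
  obtain ⟨N, hN⟩ := hL (ε / 4) (by positivity)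
  set M := max N 0
  have hM0 : 0 ≤ M := le_max_right _ _
  set C := |g M - L * M|
  have hC0 : 0 ≤ C := abs_nonneg _
  refine ⟨max M (4 * C / ε) + 1, fun x hx => ?_⟩
  have hxM : M ≤ x := by linarith [le_max_left M (4 * C / ε)]
  have hxC : 4 * C / ε ≤ x := by linarith [le_max_right M (4 * C / ε)]
  have hx0 : 0 < x := by linarith [le_max_left M (4 * C / ε)]
  have hmv := (convex_Ici M).norm_image_sub_le_of_norm_hasDerivWithin_le
    (f := fun x => g x - L * x) (f' := fun x => g' x - L) (C := ε / 4)
    (fun y _ => ((hg y).sub (by simpa using (hasDerivAt_id y).const_mul L)).hasDerivWithinAt)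
    (fun y hy => by
      have := hN y ((le_max_left N 0).trans hy)
      rw [Real.dist_eq] at this
      exact this.le)
    (Set.mem_Ici.2 le_rfl) (Set.mem_Ici.2 hxM)
  simp only [Real.norm_eq_abs] at hmv
  rw [abs_of_nonneg (sub_nonneg.2 hxM)] at hmv
  rw [div_le_iff₀ hε] at hxC
  have htri : |g x - L * x| ≤ C + |g x - L * x - (g M - L * M)| := by
    have := abs_add_le (g M - L * M) (g x - L * x - (g M - L * M))
    rwa [add_sub_cancel] at this
  rw [Real.dist_eq, show g x / x - L = (g x - L * x) / x by field_simp, abs_div, abs_of_pos hx0,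
    div_lt_iff₀ hx0]
  nlinarith [mul_pos hε hx0, mul_nonneg hε.le hM0]

/-- Under (ϑ1)-(ϑ3), lim_{s→∞} f(s)/√s = (8/α²)^{1/4}, and lim_{|s|→∞} |f(s)|/√|s| = (8/α²)^{1/4}. -/
theorem stmt_6
    (ϑ f : ℝ → ℝ)
    (hϑ_even : ∀ s, ϑ (-s) = ϑ s)
    (hϑ_C1 : ContDiff ℝ 1 ϑ)
    (hϑ_ge1 : ∀ s, 1 ≤ ϑ s)
    (hf_odd : ∀ s, f (-s) = - f s)
    (hf_zero : f 0 = 0)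
    (hf_C2 : ContDiff ℝ 2 f)
    (hf_mono : StrictMono f)
    (hf_surj : Function.Surjective f)
    (hf_deriv : ∀ s, HasDerivAt f (1 / Real.sqrt (ϑ (f s))) s)
    (hϑ1_dec : StrictAntiOn ϑ (Set.Iio 0))
    (hϑ1_inc : StrictMonoOn ϑ (Set.Ioi 0))
    (hϑ2_neg : MonotoneOn (fun s => ϑ s / s ^ 2) (Set.Iio 0))
    (hϑ2_pos : AntitoneOn (fun s => ϑ s / s ^ 2) (Set.Ioi 0))
    (α : ℝ) (hα : 0 < α)
    (hϑ3_top : Filter.Tendsto (fun s => ϑ s / s ^ 2) Filter.atTop (nhds (α ^ 2 / 2)))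
    (hϑ3_bot : Filter.Tendsto (fun s => ϑ s / s ^ 2) Filter.atBot (nhds (α ^ 2 / 2))) :
    Tendsto (fun s => f s / Real.sqrt s) atTop (𝓝 ((8 / α ^ 2) ^ ((1:ℝ) / 4))) ∧
    Tendsto (fun s => |f s| / Real.sqrt |s|) atTop (𝓝 ((8 / α ^ 2) ^ ((1:ℝ) / 4))) ∧
    Tendsto (fun s => |f s| / Real.sqrt |s|) atBot (𝓝 ((8 / α ^ 2) ^ ((1:ℝ) / 4))) := by
  have hf_top : Tendsto f atTop atTop := hf_mono.monotone.tendsto_atTop_atTop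
    fun b => (hf_surj b).imp fun _ h => h.ge
  have hderiv_sq : ∀ s, HasDerivAt (fun s => f s ^ 2) (2 * (f s / Real.sqrt (ϑ (f s)))) s := by
    intro s
    refine ((hf_deriv s).fun_pow 2).congr_deriv ?_
    push_cast
    ring
  have hratio : Tendsto (fun t => t / Real.sqrt (ϑ t)) atTop (𝓝 (Real.sqrt (α ^ 2 / 2))⁻¹) := by
    refine (hϑ3_top.sqrt.inv₀ (by positivity)).congr' ?_
    filter_upwards [eventually_ge_atTop 0] with t ht
    rw [Real.sqrt_div' _ (sq_nonneg t), Real.sqrt_sq ht, inv_div]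
  have hsq := tendsto_div_id_of_tendsto_deriv hderiv_sq ((hratio.comp hf_top).const_mul 2)
  have hconst : Real.sqrt (2 * (Real.sqrt (α ^ 2 / 2))⁻¹) = (8 / α ^ 2) ^ ((1 : ℝ) / 4) := by
    have h2 : 2 * (Real.sqrt (α ^ 2 / 2))⁻¹ = Real.sqrt (8 / α ^ 2) := by
      rw [← Real.sqrt_inv, ← Real.sqrt_sq (zero_le_two (α := ℝ)), ← Real.sqrt_mul (by positivity),
        Real.sqrt_sq zero_le_two]
      congr 1
      field_simp
      norm_num
    rw [h2, Real.sqrt_eq_rpow, Real.sqrt_eq_rpow, ← Real.rpow_mul (by positivity)]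
    norm_num
  have hlim : Tendsto (fun s => f s / Real.sqrt s) atTop (𝓝 ((8 / α ^ 2) ^ ((1 : ℝ) / 4))) := by
    rw [← hconst]
    refine hsq.sqrt.congr' ?_
    filter_upwards [hf_top.eventually_ge_atTop 0] with s hs
    rw [Real.sqrt_div (sq_nonneg _), Real.sqrt_sq hs]
  have habs : Tendsto (fun s => |f s| / Real.sqrt |s|) atTop
      (𝓝 ((8 / α ^ 2) ^ ((1 : ℝ) / 4))) := by
    refine hlim.congr' ?_
    filter_upwards [hf_top.eventually_ge_atTop 0, eventually_ge_atTop 0] with s hs hs'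
    rw [abs_of_nonneg hs, abs_of_nonneg hs']
  refine ⟨hlim, habs, (habs.comp tendsto_neg_atBot_atTop).congr fun s => ?_⟩
  simp [hf_odd]
end

section
/- Assume (ϑ1), (ϑ2) and (ϑ3). Then lim_{|s|→∞} f(s)/s = 0. -/
open Filter Topology Set

/-- If `g` is antitone on `(0, ∞)` then it dominates its limit at infinity there. -/
theorem le_of_antitoneOn_Ioi_of_tendsto {g : ℝ → ℝ} {l t : ℝ} (hg : AntitoneOn g (Ioi 0))
    (hl : Tendsto g atTop (𝓝 l)) (ht : 0 < t) : l ≤ g t := by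
  refine le_of_tendsto hl ?_
  filter_upwards [eventually_ge_atTop t] with x hx
  exact hg ht (ht.trans_le hx) hx

/-- A function with `f 0 = 0` and `f * f' ≤ K` on `[0, ∞)` grows at most like `√(2 * K * s)`. -/
theorem sq_le_of_mul_deriv_le {f f' : ℝ → ℝ} {K : ℝ} (hf : ∀ s, HasDerivAt f (f' s) s)
    (hf_zero : f 0 = 0) (hK : ∀ s, 0 < s → f s * f' s ≤ K) {s : ℝ} (hs : 0 ≤ s) :
    f s ^ 2 ≤ 2 * K * s := by
  have hd : ∀ x, HasDerivAt (fun x => f x ^ 2 - 2 * K * x) (2 * (f x * f' x) - 2 * K) x := by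
    intro x
    refine (((hf x).fun_pow 2).fun_sub ((hasDerivAt_id' x).const_mul (2 * K))).congr_deriv ?_
    push_cast
    ring
  have hanti : AntitoneOn (fun x => f x ^ 2 - 2 * K * x) (Ici 0) := by
    refine antitoneOn_of_deriv_nonpos (convex_Ici 0)
      (fun x _ => (hd x).continuousAt.continuousWithinAt)
      (fun x _ => (hd x).differentiableAt.differentiableWithinAt) fun x hx => ?_
    rw [interior_Ici] at hx
    rw [(hd x).deriv]
    linarith [hK x hx]
  have := hanti self_mem_Ici hs hs
  simp only [hf_zero] at this
  linarith

/-- A function with `f s ^ 2 ≤ C * s` on `(0, ∞)` is sublinear at infinity. -/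
theorem tendsto_div_self_atTop_of_sq_le {f : ℝ → ℝ} {C : ℝ}
    (h : ∀ s, 0 < s → f s ^ 2 ≤ C * s) : Tendsto (fun s => f s / s) atTop (𝓝 0) := by
  have hsq : Tendsto (fun s => (f s / s) ^ 2) atTop (𝓝 0) := by
    refine squeeze_zero' (Eventually.of_forall fun s => sq_nonneg _) ?_
      (tendsto_id.const_div_atTop C)
    filter_upwards [eventually_gt_atTop 0] with s hs
    rw [div_pow, id, div_le_div_iff₀ (by positivity) hs]
    nlinarith [h s hs]
  rw [tendsto_zero_iff_abs_tendsto_zero]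
  simpa [Function.comp_def, Real.sqrt_sq_eq_abs] using hsq.sqrt

/-- Under (ϑ1)-(ϑ3), lim_{|s|→∞} f(s)/s = 0. -/
theorem stmt_7
    (ϑ f : ℝ → ℝ)
    (hϑ_even : ∀ s, ϑ (-s) = ϑ s)
    (hϑ_C1 : ContDiff ℝ 1 ϑ)
    (hϑ_ge1 : ∀ s, 1 ≤ ϑ s)
    (hf_odd : ∀ s, f (-s) = - f s)
    (hf_zero : f 0 = 0)
    (hf_C2 : ContDiff ℝ 2 f)
    (hf_mono : StrictMono f)
    (hf_surj : Function.Surjective f)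
    (hf_deriv : ∀ s, HasDerivAt f (1 / Real.sqrt (ϑ (f s))) s)
    (hϑ1_dec : StrictAntiOn ϑ (Set.Iio 0))
    (hϑ1_inc : StrictMonoOn ϑ (Set.Ioi 0))
    (hϑ2_neg : MonotoneOn (fun s => ϑ s / s ^ 2) (Set.Iio 0))
    (hϑ2_pos : AntitoneOn (fun s => ϑ s / s ^ 2) (Set.Ioi 0))
    (α : ℝ) (hα : 0 < α)
    (hϑ3_top : Filter.Tendsto (fun s => ϑ s / s ^ 2) Filter.atTop (nhds (α ^ 2 / 2)))
    (hϑ3_bot : Filter.Tendsto (fun s => ϑ s / s ^ 2) Filter.atBot (nhds (α ^ 2 / 2))) :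
    Tendsto (fun s => f s / s) atTop (𝓝 0) ∧ Tendsto (fun s => f s / s) atBot (𝓝 0) := by
  have hbound : ∀ t, 0 < t → α / 2 * t ≤ Real.sqrt (ϑ t) := by
    intro t ht
    have h := le_of_antitoneOn_Ioi_of_tendsto hϑ2_pos hϑ3_top ht
    rw [le_div_iff₀ (by positivity)] at h
    refine Real.le_sqrt_of_sq_le ?_
    nlinarith [mul_pos hα ht]
  have hK : ∀ s, 0 < s → f s * (1 / Real.sqrt (ϑ (f s))) ≤ 2 / α := by
    intro s hs
    have hpos : 0 < f s := hf_zero ▸ hf_mono hs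
    have hsqrt : 0 < Real.sqrt (ϑ (f s)) :=
      Real.sqrt_pos.2 (zero_lt_one.trans_le (hϑ_ge1 _))
    rw [mul_one_div, div_le_div_iff₀ hsqrt hα]
    linarith [hbound _ hpos]
  have htop : Tendsto (fun s => f s / s) atTop (𝓝 0) :=
    tendsto_div_self_atTop_of_sq_le fun s hs =>
      sq_le_of_mul_deriv_le hf_deriv hf_zero hK hs.le
  refine ⟨htop, ?_⟩
  simpa [Function.comp_def, hf_odd] using htop.comp tendsto_neg_atBot_atTop
end

section
/- Assume (ϑ1), (ϑ2) and (ϑ3). Then lim_{s→∞} f'(s) f(s) = √2/α, and consequently there exists a constant C > 0 such that |f'(s) f(s)| ≤ C for all s ∈ ℝ. -/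
open Filter Topology Set

/-- If `h t / t ^ 2` is antitone on `(0, ∞)` and tends to `l`, then `l * t ^ 2` bounds the even
function `h` from below. -/
lemma mul_sq_le_of_antitoneOn_div_sq {h : ℝ → ℝ} {l : ℝ} (h_even : ∀ t, h (-t) = h t)
    (h_zero : 0 ≤ h 0) (h_anti : AntitoneOn (fun t => h t / t ^ 2) (Ioi 0))
    (h_lim : Tendsto (fun t => h t / t ^ 2) atTop (𝓝 l)) (t : ℝ) : l * t ^ 2 ≤ h t := by
  have pos : ∀ t, 0 < t → l * t ^ 2 ≤ h t := by
    intro t ht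
    rw [← le_div_iff₀ (by positivity)]
    refine le_of_tendsto h_lim ?_
    filter_upwards [eventually_ge_atTop t] with u hu
    exact h_anti ht (ht.trans_le hu) hu
  rcases lt_trichotomy t 0 with ht | rfl | ht
  · simpa [h_even] using pos (-t) (neg_pos.2 ht)
  · simpa using h_zero
  · exact pos t ht

/-- Under (ϑ1)-(ϑ3), lim_{s→∞} f'(s)f(s) = √2/α and there is C > 0 with |f'(s)f(s)| ≤ C for all s. -/
theorem stmt_8
    (ϑ f : ℝ → ℝ)
    (hϑ_even : ∀ s, ϑ (-s) = ϑ s)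
    (hϑ_C1 : ContDiff ℝ 1 ϑ)
    (hϑ_ge1 : ∀ s, 1 ≤ ϑ s)
    (hf_odd : ∀ s, f (-s) = - f s)
    (hf_zero : f 0 = 0)
    (hf_C2 : ContDiff ℝ 2 f)
    (hf_mono : StrictMono f)
    (hf_surj : Function.Surjective f)
    (hf_deriv : ∀ s, HasDerivAt f (1 / Real.sqrt (ϑ (f s))) s)
    (hϑ1_dec : StrictAntiOn ϑ (Set.Iio 0))
    (hϑ1_inc : StrictMonoOn ϑ (Set.Ioi 0))
    (hϑ2_neg : MonotoneOn (fun s => ϑ s / s ^ 2) (Set.Iio 0))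
    (hϑ2_pos : AntitoneOn (fun s => ϑ s / s ^ 2) (Set.Ioi 0))
    (α : ℝ) (hα : 0 < α)
    (hϑ3_top : Filter.Tendsto (fun s => ϑ s / s ^ 2) Filter.atTop (nhds (α ^ 2 / 2)))
    (hϑ3_bot : Filter.Tendsto (fun s => ϑ s / s ^ 2) Filter.atBot (nhds (α ^ 2 / 2))) :
    Tendsto (fun s => deriv f s * f s) atTop (𝓝 (Real.sqrt 2 / α)) ∧
    ∃ C : ℝ, 0 < C ∧ ∀ s : ℝ, |deriv f s * f s| ≤ C := by
  have hsqrt : Real.sqrt (α ^ 2 / 2) = α / Real.sqrt 2 := by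
    rw [Real.sqrt_div (sq_nonneg α), Real.sqrt_sq hα.le]
  have hderiv : ∀ s, deriv f s * f s = f s / Real.sqrt (ϑ (f s)) := fun s => by
    rw [(hf_deriv s).deriv]; ring
  simp only [hderiv]
  constructor
  · have hf_top : Tendsto f atTop atTop :=
      hf_mono.monotone.tendsto_atTop_atTop fun b => (hf_surj b).imp fun _ h => h.ge
    have hlim : Tendsto (fun t => (Real.sqrt (ϑ t / t ^ 2))⁻¹) atTop (𝓝 (Real.sqrt 2 / α)) := by
      rw [← inv_div α, ← hsqrt]
      exact hϑ3_top.sqrt.inv₀ (by positivity)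
    refine Tendsto.comp (g := fun t => t / Real.sqrt (ϑ t)) (hlim.congr' ?_) hf_top
    filter_upwards [eventually_gt_atTop 0] with t ht
    rw [Real.sqrt_div (by linarith [hϑ_ge1 t]), Real.sqrt_sq ht.le, inv_div]
  · refine ⟨Real.sqrt 2 / α, by positivity, fun s => ?_⟩
    have hpos : 0 < Real.sqrt (ϑ (f s)) := Real.sqrt_pos.2 (by linarith [hϑ_ge1 (f s)])
    have hle := Real.sqrt_le_sqrt (mul_sq_le_of_antitoneOn_div_sq hϑ_even
      (by linarith [hϑ_ge1 0]) hϑ2_pos hϑ3_top (f s))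
    rw [Real.sqrt_mul (by positivity), Real.sqrt_sq_eq_abs, hsqrt] at hle
    rw [abs_div, abs_of_pos hpos, div_le_iff₀ hpos]
    calc |f s| = Real.sqrt 2 / α * (α / Real.sqrt 2 * |f s|) := by field_simp
      _ ≤ Real.sqrt 2 / α * Real.sqrt (ϑ (f s)) := by gcongr
end

section
/- Assume (ϑ1), (ϑ2) and (ϑ3). Then for all s ∈ ℝ one has |f(s)| ≤ (8/α²)^{1/4} √|s|. -/
open Filter Topology Set

/-- If `t ↦ u t / t ^ 2` is antitone on `(0, ∞)` with limit `l` at infinity, then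
`u` dominates `l * t ^ 2` there. -/
lemma mul_sq_le_of_antitoneOn_div_sq_s9 {u : ℝ → ℝ} {l : ℝ}
    (hu : AntitoneOn (fun s => u s / s ^ 2) (Set.Ioi 0))
    (hlim : Filter.Tendsto (fun s => u s / s ^ 2) Filter.atTop (nhds l))
    {t : ℝ} (ht : 0 < t) : l * t ^ 2 ≤ u t := by
  rw [← le_div_iff₀ (by positivity)]
  refine le_of_tendsto hlim ?_
  filter_upwards [Filter.eventually_ge_atTop t] with x hx
  exact hu ht (ht.trans_le hx) hx

/-- Under (ϑ1)-(ϑ3), |f(s)| ≤ (8/α²)^{1/4} √|s| for all s ∈ ℝ. -/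
theorem stmt_9
    (ϑ f : ℝ → ℝ)
    (hϑ_even : ∀ s, ϑ (-s) = ϑ s)
    (hϑ_C1 : ContDiff ℝ 1 ϑ)
    (hϑ_ge1 : ∀ s, 1 ≤ ϑ s)
    (hf_odd : ∀ s, f (-s) = - f s)
    (hf_zero : f 0 = 0)
    (hf_C2 : ContDiff ℝ 2 f)
    (hf_mono : StrictMono f)
    (hf_surj : Function.Surjective f)
    (hf_deriv : ∀ s, HasDerivAt f (1 / Real.sqrt (ϑ (f s))) s)
    (hϑ1_dec : StrictAntiOn ϑ (Set.Iio 0))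
    (hϑ1_inc : StrictMonoOn ϑ (Set.Ioi 0))
    (hϑ2_neg : MonotoneOn (fun s => ϑ s / s ^ 2) (Set.Iio 0))
    (hϑ2_pos : AntitoneOn (fun s => ϑ s / s ^ 2) (Set.Ioi 0))
    (α : ℝ) (hα : 0 < α)
    (hϑ3_top : Filter.Tendsto (fun s => ϑ s / s ^ 2) Filter.atTop (nhds (α ^ 2 / 2)))
    (hϑ3_bot : Filter.Tendsto (fun s => ϑ s / s ^ 2) Filter.atBot (nhds (α ^ 2 / 2))) :
    ∀ s : ℝ, |f s| ≤ (8 / α ^ 2) ^ ((1:ℝ) / 4) * Real.sqrt |s| := by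
  have hc_sq : Real.sqrt (8 / α ^ 2) ^ 2 = 8 / α ^ 2 := Real.sq_sqrt (by positivity)
  have hslope : ∀ t, 2 * t * (1 / Real.sqrt (ϑ t)) ≤ Real.sqrt (8 / α ^ 2) := by
    intro t
    have hpos : 0 < ϑ t := one_pos.trans_le (hϑ_ge1 t)
    rw [mul_one_div, div_le_iff₀ (Real.sqrt_pos.2 hpos)]
    rcases le_or_gt t 0 with ht | ht
    · exact (by linarith : 2 * t ≤ 0).trans (by positivity)
    · refine (le_abs_self _).trans (abs_le_of_sq_le_sq ?_ (by positivity))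
      rw [mul_pow, mul_pow, hc_sq, Real.sq_sqrt hpos.le, div_mul_eq_mul_div,
        le_div_iff₀ (by positivity)]
      linarith [mul_sq_le_of_antitoneOn_div_sq_s9 hϑ2_pos hϑ3_top ht]
  have hderiv : ∀ s, HasDerivAt (fun s => Real.sqrt (8 / α ^ 2) * s - f s ^ 2)
      (Real.sqrt (8 / α ^ 2) - 2 * f s * (1 / Real.sqrt (ϑ (f s)))) s := by
    intro s
    refine (((hasDerivAt_id' s).const_mul _).sub ((hf_deriv s).pow 2)).congr_deriv ?_
    rw [mul_one, pow_one, Nat.cast_ofNat]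
  have hmono : Monotone (fun s => Real.sqrt (8 / α ^ 2) * s - f s ^ 2) :=
    monotone_of_hasDerivAt_nonneg hderiv fun s => sub_nonneg.2 (hslope (f s))
  have hsq : ∀ s, f s ^ 2 ≤ Real.sqrt (8 / α ^ 2) * |s| := by
    intro s
    have h := hmono (abs_nonneg s)
    have habs : f |s| ^ 2 = f s ^ 2 := by
      rcases abs_choice s with h | h <;> simp [h, hf_odd]
    simp only [hf_zero, habs] at h
    linarith
  intro s
  refine abs_le_of_sq_le_sq ?_ (by positivity)
  rw [mul_pow, Real.sq_sqrt (abs_nonneg s), ← Real.rpow_mul_natCast (by positivity)]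
  have hexp : (1 : ℝ) / 4 * (2 : ℕ) = 1 / 2 := by norm_num
  rw [hexp, ← Real.sqrt_eq_rpow]
  exact hsq s
end

section
/- Assume (ϑ1) and (ϑ2). Then for all s ∈ ℝ with |s| ≥ 1 one has |f(s)| ≥ f(1) √|s|, where f(1) > 0. -/
open Filter Topology Set

/-- If `ϑ(t)/t²` is nonincreasing on `(0, ∞)` and `f' = ϑ(f)^{-1/2}`, then `f √ϑ(f) ≤ 2s`. -/
lemma mul_sqrt_le_two_mul {ϑ f : ℝ → ℝ} (hϑ : ∀ t, 1 ≤ ϑ t) (hf_zero : f 0 = 0)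
    (hf_mono : StrictMono f) (hf_deriv : ∀ s, HasDerivAt f (1 / √(ϑ (f s))) s)
    (hϑ_anti : AntitoneOn (fun t => ϑ t / t ^ 2) (Ioi 0)) {s : ℝ} (hs : 0 < s) :
    f s * √(ϑ (f s)) ≤ 2 * s := by
  have hf_pos : ∀ {r : ℝ}, 0 < r → 0 < f r := fun hr => hf_zero ▸ hf_mono hr
  have hsqrt_pos : ∀ t, 0 < √(ϑ t) := fun t => Real.sqrt_pos.2 (by linarith [hϑ t])
  have hcomp : ∀ r, 0 < r → r < s → f r * √(ϑ (f s)) ≤ f s * √(ϑ (f r)) := by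
    intro r hr hrs
    have hquot := hϑ_anti (hf_pos hr) (hf_pos hs) (hf_mono hrs).le
    have hfr := hf_pos hr
    have hfs := hf_pos hs
    rw [div_le_div_iff₀ (by positivity) (by positivity)] at hquot
    refine le_of_sq_le_sq ?_ (by positivity)
    rw [mul_pow, mul_pow, Real.sq_sqrt (by linarith [hϑ (f s)]),
      Real.sq_sqrt (by linarith [hϑ (f r)])]
    linarith
  have hderiv : ∀ r, HasDerivAt (fun r => 2 * r * f s - f r ^ 2 * √(ϑ (f s)))
      (2 * f s - 2 * f r * (1 / √(ϑ (f r))) * √(ϑ (f s))) r := by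
    intro r
    have h := (((hasDerivAt_id r).const_mul 2).mul_const (f s)).sub
      (((hf_deriv r).pow 2).mul_const (√(ϑ (f s))))
    exact h.congr_deriv (by simp)
  have hmono : MonotoneOn (fun r => 2 * r * f s - f r ^ 2 * √(ϑ (f s))) (Icc 0 s) := by
    refine monotoneOn_of_deriv_nonneg (convex_Icc 0 s)
      (fun r _ => (hderiv r).continuousAt.continuousWithinAt)
      (fun r _ => (hderiv r).differentiableAt.differentiableWithinAt) ?_
    intro r hr
    rw [interior_Icc] at hr
    rw [(hderiv r).deriv]
    have hle : f r * √(ϑ (f s)) / √(ϑ (f r)) ≤ f s :=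
      (div_le_iff₀ (hsqrt_pos _)).2 (hcomp r hr.1 hr.2)
    have heq : 2 * f r * (1 / √(ϑ (f r))) * √(ϑ (f s)) =
      2 * (f r * √(ϑ (f s)) / √(ϑ (f r))) := by ring
    linarith
  have hle := hmono (left_mem_Icc.2 hs.le) (right_mem_Icc.2 hs.le) hs.le
  simp only [hf_zero] at hle
  refine le_of_mul_le_mul_left ?_ (hf_pos hs)
  linarith

/-- Under the same assumptions, `f(s)²/s` is nondecreasing on `(0, ∞)`. -/
lemma monotoneOn_sq_div {ϑ f : ℝ → ℝ} (hϑ : ∀ t, 1 ≤ ϑ t) (hf_zero : f 0 = 0)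
    (hf_mono : StrictMono f) (hf_deriv : ∀ s, HasDerivAt f (1 / √(ϑ (f s))) s)
    (hϑ_anti : AntitoneOn (fun t => ϑ t / t ^ 2) (Ioi 0)) :
    MonotoneOn (fun s => f s ^ 2 / s) (Ioi 0) := by
  have hderiv : ∀ s ∈ Ioi (0 : ℝ), HasDerivAt (fun s => f s ^ 2 / s)
      ((2 * f s * (1 / √(ϑ (f s))) * s - f s ^ 2) / s ^ 2) s := by
    intro s hs
    exact (((hf_deriv s).pow 2).div (hasDerivAt_id s) (ne_of_gt hs)).congr_deriv (by simp)
  refine monotoneOn_of_deriv_nonneg (convex_Ioi 0)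
    (fun s hs => (hderiv s hs).continuousAt.continuousWithinAt)
    (fun s hs => (hderiv s (interior_subset hs)).differentiableAt.differentiableWithinAt) ?_
  intro s hs
  have hs : 0 < s := interior_subset hs
  rw [(hderiv s hs).deriv]
  have hfs : 0 < f s := hf_zero ▸ hf_mono hs
  have hsqrt : 0 < √(ϑ (f s)) := Real.sqrt_pos.2 (by linarith [hϑ (f s)])
  have hle : f s ≤ 2 * s / √(ϑ (f s)) :=
    (le_div_iff₀ hsqrt).2 (mul_sqrt_le_two_mul hϑ hf_zero hf_mono hf_deriv hϑ_anti hs)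
  have heq : 2 * f s * (1 / √(ϑ (f s))) * s - f s ^ 2 =
      f s * (2 * s / √(ϑ (f s)) - f s) := by ring
  rw [heq]
  exact div_nonneg (mul_nonneg hfs.le (sub_nonneg.2 hle)) (sq_nonneg s)

/-- Under (ϑ1)-(ϑ2), f(1) > 0 and |f(s)| ≥ f(1)√|s| for all |s| ≥ 1. -/
theorem stmt_10
    (ϑ f : ℝ → ℝ)
    (hϑ_even : ∀ s, ϑ (-s) = ϑ s)
    (hϑ_C1 : ContDiff ℝ 1 ϑ)
    (hϑ_ge1 : ∀ s, 1 ≤ ϑ s)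
    (hf_odd : ∀ s, f (-s) = - f s)
    (hf_zero : f 0 = 0)
    (hf_C2 : ContDiff ℝ 2 f)
    (hf_mono : StrictMono f)
    (hf_surj : Function.Surjective f)
    (hf_deriv : ∀ s, HasDerivAt f (1 / Real.sqrt (ϑ (f s))) s)
    (hϑ1_dec : StrictAntiOn ϑ (Set.Iio 0))
    (hϑ1_inc : StrictMonoOn ϑ (Set.Ioi 0))
    (hϑ2_neg : MonotoneOn (fun s => ϑ s / s ^ 2) (Set.Iio 0))
    (hϑ2_pos : AntitoneOn (fun s => ϑ s / s ^ 2) (Set.Ioi 0)) :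
    0 < f 1 ∧ ∀ s : ℝ, 1 ≤ |s| → f 1 * Real.sqrt |s| ≤ |f s| := by
  have hf_pos : ∀ {s : ℝ}, 0 < s → 0 < f s := fun hs => hf_zero ▸ hf_mono hs
  have hpos_case : ∀ s : ℝ, 1 ≤ s → f 1 * √s ≤ f s := by
    intro s hs
    have hs0 : 0 < s := by linarith
    have hle := monotoneOn_sq_div hϑ_ge1 hf_zero hf_mono hf_deriv hϑ2_pos
      (mem_Ioi.2 one_pos) (mem_Ioi.2 hs0) hs
    simp only [div_one] at hle
    rw [le_div_iff₀ hs0] at hle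
    refine le_of_sq_le_sq ?_ (hf_pos hs0).le
    rwa [mul_pow, Real.sq_sqrt hs0.le]
  refine ⟨hf_pos one_pos, fun s hs => (hpos_case |s| hs).trans ?_⟩
  rcases abs_choice s with h | h <;> rw [h]
  · exact le_abs_self _
  · rw [hf_odd]
    exact neg_le_abs _
end

section
/- Assume (ϑ1), (ϑ2) and (ϑ3), and let q ∈ (0, 3). Then for every s ≠ 0 one has g(s)/s ≤ (8/α²)^{(q+1)/4} |s|^{-(3-q)/2}, and consequently lim_{|s|→∞} g(s)/s = 0. -/
open Filter Topology Set

/-- A function that is antitone on the positive half-line is bounded below there by its limit. -/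
lemma AntitoneOn.le_of_tendsto_atTop_Ioi {h : ℝ → ℝ} {c t : ℝ} (hh : AntitoneOn h (Set.Ioi 0))
    (hlim : Tendsto h atTop (𝓝 c)) (ht : 0 < t) : c ≤ h t :=
  le_of_tendsto hlim <| by
    filter_upwards [eventually_ge_atTop t] with x hx
    exact hh ht (ht.trans_le hx) hx

/-- If `ϑ` is increasing on the positive half-line, then `s * f' s ≤ f s`. -/
lemma mul_inv_sqrt_le_self {ϑ f : ℝ → ℝ} (hϑ_ge1 : ∀ s, 1 ≤ ϑ s) (hf_zero : f 0 = 0)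
    (hf_mono : StrictMono f) (hf_deriv : ∀ s, HasDerivAt f (1 / √(ϑ (f s))) s)
    (hϑ_inc : StrictMonoOn ϑ (Set.Ioi 0)) {s : ℝ} (hs : 0 < s) :
    1 / √(ϑ (f s)) * s ≤ f s := by
  obtain ⟨c, hc, hc'⟩ := exists_hasDerivAt_eq_slope f _ hs
    (fun x _ => (hf_deriv x).continuousAt.continuousWithinAt) (fun x _ => hf_deriv x)
  rw [hf_zero, sub_zero, sub_zero, eq_div_iff hs.ne'] at hc'
  have hfc : 0 < f c := hf_zero ▸ hf_mono hc.1
  have hfs : f c < f s := hf_mono hc.2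
  have hle : ϑ (f c) ≤ ϑ (f s) := (hϑ_inc hfc (hfc.trans hfs) hfs).le
  have hpos : 0 < √(ϑ (f c)) := Real.sqrt_pos.2 (zero_lt_one.trans_le (hϑ_ge1 _))
  refine le_of_le_of_eq ?_ hc'
  gcongr

/-- Quadratic growth of `ϑ` forces `f` to grow at most like a square root. -/
lemma sq_le_sqrt_mul {ϑ f : ℝ → ℝ} {α : ℝ} (hα : 0 < α) (hϑ_ge1 : ∀ s, 1 ≤ ϑ s)
    (hf_zero : f 0 = 0) (hf_mono : StrictMono f)
    (hf_deriv : ∀ s, HasDerivAt f (1 / √(ϑ (f s))) s)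
    (hϑ_quad : ∀ t, 0 < t → α ^ 2 / 2 ≤ ϑ t / t ^ 2) {s : ℝ} (hs : 0 < s) :
    f s ^ 2 ≤ √(8 / α ^ 2) * s := by
  have hd : ∀ x, HasDerivAt (fun y => f y ^ 2) (2 * f x * (1 / √(ϑ (f x)))) x := fun x => by
    simpa using (hf_deriv x).fun_pow 2
  obtain ⟨c, hc, hc'⟩ := exists_hasDerivAt_eq_slope (fun y => f y ^ 2) _ hs
    (fun x _ => (hd x).continuousAt.continuousWithinAt) (fun x _ => hd x)
  simp only [hf_zero, sub_zero, ne_eq, OfNat.ofNat_ne_zero, not_false_eq_true, zero_pow] at hc'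
  rw [eq_div_iff hs.ne'] at hc'
  rw [← hc']
  have hfc : 0 < f c := hf_zero ▸ hf_mono hc.1
  have hϑpos : 0 < ϑ (f c) := zero_lt_one.trans_le (hϑ_ge1 _)
  have hq := hϑ_quad _ hfc
  rw [le_div_iff₀ (by positivity)] at hq
  gcongr
  apply Real.le_sqrt_of_sq_le
  rw [mul_pow, div_pow, one_pow, Real.sq_sqrt hϑpos.le, mul_one_div, div_le_div_iff₀ hϑpos (by positivity)]
  nlinarith

/-- Under (ϑ1)-(ϑ3) and q ∈ (0,3): g(s)/s ≤ (8/α²)^{(q+1)/4}|s|^{-(3-q)/2} for s ≠ 0, hence lim_{|s|→∞} g(s)/s = 0. -/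
theorem stmt_14
    (ϑ f : ℝ → ℝ)
    (hϑ_even : ∀ s, ϑ (-s) = ϑ s)
    (hϑ_C1 : ContDiff ℝ 1 ϑ)
    (hϑ_ge1 : ∀ s, 1 ≤ ϑ s)
    (hf_odd : ∀ s, f (-s) = - f s)
    (hf_zero : f 0 = 0)
    (hf_C2 : ContDiff ℝ 2 f)
    (hf_mono : StrictMono f)
    (hf_surj : Function.Surjective f)
    (hf_deriv : ∀ s, HasDerivAt f (1 / Real.sqrt (ϑ (f s))) s)
    (hϑ1_dec : StrictAntiOn ϑ (Set.Iio 0))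
    (hϑ1_inc : StrictMonoOn ϑ (Set.Ioi 0))
    (hϑ2_neg : MonotoneOn (fun s => ϑ s / s ^ 2) (Set.Iio 0))
    (hϑ2_pos : AntitoneOn (fun s => ϑ s / s ^ 2) (Set.Ioi 0))
    (α : ℝ) (hα : 0 < α)
    (hϑ3_top : Filter.Tendsto (fun s => ϑ s / s ^ 2) Filter.atTop (nhds (α ^ 2 / 2)))
    (hϑ3_bot : Filter.Tendsto (fun s => ϑ s / s ^ 2) Filter.atBot (nhds (α ^ 2 / 2)))
    (q : ℝ) (g : ℝ → ℝ)
    (hg : ∀ s, g s = deriv f s * |f s| ^ (q - 1) * f s)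
    (hq0 : 0 < q) (hq3 : q < 3) :
    (∀ s : ℝ, s ≠ 0 → g s / s ≤ (8 / α ^ 2) ^ ((q + 1) / 4) * |s| ^ (-((3 - q) / 2))) ∧
    Tendsto (fun s => g s / s) atTop (𝓝 0) ∧
    Tendsto (fun s => g s / s) atBot (𝓝 0) := by
  have hg_nonneg : ∀ s, 0 < s → 0 ≤ g s / s := fun s hs => by
    have hfs : 0 < f s := hf_zero ▸ hf_mono hs
    rw [hg, (hf_deriv s).deriv]
    positivity
  have hg_even : ∀ s, g (-s) / (-s) = g s / s := fun s => by
    rw [hg, hg, (hf_deriv _).deriv, (hf_deriv _).deriv, hf_odd, hϑ_even, abs_neg, mul_neg,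
      neg_div_neg_eq]
  have hbound_pos : ∀ s : ℝ, 0 < s →
      g s / s ≤ (8 / α ^ 2) ^ ((q + 1) / 4) * s ^ (-((3 - q) / 2)) := fun s hs => by
    have hfs : 0 < f s := hf_zero ▸ hf_mono hs
    have hC : 0 < 8 / α ^ 2 := by positivity
    have hslope := mul_inv_sqrt_le_self hϑ_ge1 hf_zero hf_mono hf_deriv hϑ1_inc hs
    have hsq := sq_le_sqrt_mul hα hϑ_ge1 hf_zero hf_mono hf_deriv
      (fun t ht => hϑ2_pos.le_of_tendsto_atTop_Ioi hϑ3_top ht) hs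
    have hpow : f s ^ (q + 1) ≤ (8 / α ^ 2) ^ ((q + 1) / 4) * s ^ ((q + 1) / 2) := by
      have h := Real.rpow_le_rpow (by positivity) hsq (by positivity : 0 ≤ (q + 1) / 2)
      rw [Real.mul_rpow (by positivity) hs.le, Real.sqrt_eq_rpow, ← Real.rpow_mul hC.le,
        ← Real.rpow_natCast, ← Real.rpow_mul hfs.le] at h
      convert h using 2 <;> [skip; congr 1] <;> push_cast <;> ring
    have hexp : s ^ (-((3 - q) / 2)) = s ^ ((q + 1) / 2) / s ^ 2 := by
      rw [← Real.rpow_natCast s 2, ← Real.rpow_sub hs]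
      congr 1
      push_cast
      ring
    have hfq : |f s| ^ (q - 1) * f s = f s ^ q := by
      rw [abs_of_pos hfs, ← Real.rpow_add_one hfs.ne', sub_add_cancel]
    rw [hg, (hf_deriv s).deriv, mul_assoc, hfq, hexp, ← mul_div_assoc,
      div_le_div_iff₀ hs (by positivity)]
    calc 1 / √(ϑ (f s)) * f s ^ q * s ^ 2 = (1 / √(ϑ (f s)) * s) * f s ^ q * s := by ring
      _ ≤ f s * f s ^ q * s := by gcongr
      _ = f s ^ (q + 1) * s := by rw [Real.rpow_add_one hfs.ne']; ring
      _ ≤ _ := by gcongr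
  have htop : Tendsto (fun s => g s / s) atTop (𝓝 0) := by
    refine tendsto_of_tendsto_of_tendsto_of_le_of_le' tendsto_const_nhds
      (h := fun s => (8 / α ^ 2) ^ ((q + 1) / 4) * s ^ (-((3 - q) / 2))) ?_ ?_ ?_
    · simpa using (tendsto_rpow_neg_atTop (by linarith : 0 < (3 - q) / 2)).const_mul
        ((8 / α ^ 2) ^ ((q + 1) / 4))
    · filter_upwards [eventually_gt_atTop 0] with s hs using hg_nonneg s hs
    · filter_upwards [eventually_gt_atTop 0] with s hs using hbound_pos s hs
  refine ⟨fun s hs => ?_, htop, ?_⟩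
  · rcases hs.lt_or_gt with hneg | hpos
    · rw [← hg_even, abs_of_neg hneg]
      exact hbound_pos _ (neg_pos.2 hneg)
    · rw [abs_of_pos hpos]
      exact hbound_pos s hpos
  · exact (htop.comp tendsto_neg_atBot_atTop).congr hg_even
end

section
/- Assume (ϑ1), (ϑ2) and (ϑ3), and let q = 3. Then lim_{|s|→∞} g(s)/s = 4/α², where here g(s) = f'(s) f(s)³. -/
open Filter Topology Set

/-- If the derivative of `h` tends to `L` at infinity, then so does `h x / x`. -/
theorem tendsto_div_self_atTop_of_hasDerivAt {h h' : ℝ → ℝ} {L : ℝ}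
    (hd : ∀ x, HasDerivAt h (h' x) x) (hL : Tendsto h' atTop (𝓝 L)) :
    Tendsto (fun x => h x / x) atTop (𝓝 L) := by
  rw [Metric.tendsto_atTop] at hL ⊢
  intro ε hε
  obtain ⟨N, hN⟩ := hL (ε / 2) (half_pos hε)
  obtain ⟨M, hM⟩ : ∃ M, M = max N 1 := ⟨_, rfl⟩
  have hNM : N ≤ M := hM ▸ le_max_left _ _
  have hM1 : 1 ≤ M := hM ▸ le_max_right _ _
  refine ⟨max M (2 * |h M - L * M| / ε + 1), fun x hx => ?_⟩
  have hMx : M ≤ x := (le_max_left _ _).trans hx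
  have hx0 : 0 < x := by linarith
  have hbig : 2 * |h M - L * M| < ε * x := by
    have : 2 * |h M - L * M| / ε < x := by linarith [(le_max_right _ _).trans hx]
    rwa [div_lt_iff₀' hε] at this
  have hmv : |(h x - L * x) - (h M - L * M)| ≤ ε / 2 * |x - M| := by
    have hk : ∀ y ∈ Ici M, HasDerivWithinAt (fun y => h y - L * y) (h' y - L) (Ici M) y := by
      intro y _
      have hy := (hd y).fun_sub ((hasDerivAt_id' y).const_mul L)
      rw [mul_one] at hy
      exact hy.hasDerivWithinAt
    refine (convex_Ici M).norm_image_sub_le_of_norm_hasDerivWithin_le hk (fun y hy => ?_)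
      self_mem_Ici hMx
    simpa [Real.dist_eq] using (hN y (hNM.trans hy)).le
  rw [abs_of_nonneg (sub_nonneg.2 hMx)] at hmv
  have hdiv : h x / x - L = (h x - L * x) / x := by field_simp
  rw [Real.dist_eq, hdiv, abs_div, abs_of_pos hx0, div_lt_iff₀ hx0]
  have htri := abs_sub_abs_le_abs_sub (h x - L * x) (h M - L * M)
  nlinarith

/-- Under (ϑ1)-(ϑ3) and q = 3, i.e. g(s) = f'(s)f(s)³: lim_{|s|→∞} g(s)/s = 4/α². -/
theorem stmt_15
    (ϑ f : ℝ → ℝ)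
    (hϑ_even : ∀ s, ϑ (-s) = ϑ s)
    (hϑ_C1 : ContDiff ℝ 1 ϑ)
    (hϑ_ge1 : ∀ s, 1 ≤ ϑ s)
    (hf_odd : ∀ s, f (-s) = - f s)
    (hf_zero : f 0 = 0)
    (hf_C2 : ContDiff ℝ 2 f)
    (hf_mono : StrictMono f)
    (hf_surj : Function.Surjective f)
    (hf_deriv : ∀ s, HasDerivAt f (1 / Real.sqrt (ϑ (f s))) s)
    (hϑ1_dec : StrictAntiOn ϑ (Set.Iio 0))
    (hϑ1_inc : StrictMonoOn ϑ (Set.Ioi 0))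
    (hϑ2_neg : MonotoneOn (fun s => ϑ s / s ^ 2) (Set.Iio 0))
    (hϑ2_pos : AntitoneOn (fun s => ϑ s / s ^ 2) (Set.Ioi 0))
    (α : ℝ) (hα : 0 < α)
    (hϑ3_top : Filter.Tendsto (fun s => ϑ s / s ^ 2) Filter.atTop (nhds (α ^ 2 / 2)))
    (hϑ3_bot : Filter.Tendsto (fun s => ϑ s / s ^ 2) Filter.atBot (nhds (α ^ 2 / 2)))
    (g : ℝ → ℝ)
    (hg : ∀ s, g s = deriv f s * f s ^ 3) :
    Tendsto (fun s => g s / s) atTop (𝓝 (4 / α ^ 2)) ∧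
    Tendsto (fun s => g s / s) atBot (𝓝 (4 / α ^ 2)) := by
  have hf_top : Tendsto f atTop atTop :=
    hf_mono.monotone.tendsto_atTop_atTop fun b => (hf_surj b).imp fun _ h => h.ge
  have hsqrt : √(α ^ 2 / 2) ≠ 0 := by positivity
  have hff' : Tendsto (fun s => f s * (1 / √(ϑ (f s)))) atTop (𝓝 (1 / √(α ^ 2 / 2))) := by
    have hlim : Tendsto (fun t => 1 / √(ϑ t / t ^ 2)) atTop (𝓝 (1 / √(α ^ 2 / 2))) :=
      tendsto_const_nhds.div hϑ3_top.sqrt hsqrt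
    refine (hlim.comp hf_top).congr' ?_
    filter_upwards [hf_top.eventually_gt_atTop 0] with s hs
    simp only [Function.comp_apply]
    rw [Real.sqrt_div' _ (sq_nonneg _), Real.sqrt_sq hs.le, one_div_div, mul_one_div]
  have hsq : Tendsto (fun s => f s ^ 2 / s) atTop (𝓝 (2 * (1 / √(α ^ 2 / 2)))) := by
    refine tendsto_div_self_atTop_of_hasDerivAt
      (h' := fun s => 2 * (f s * (1 / √(ϑ (f s))))) (fun s => ?_) (hff'.const_mul 2)
    simpa [mul_assoc] using (hf_deriv s).fun_pow 2
  have htop : Tendsto (fun s => g s / s) atTop (𝓝 (4 / α ^ 2)) := by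
    have hval : 1 / √(α ^ 2 / 2) * (2 * (1 / √(α ^ 2 / 2))) = 4 / α ^ 2 := by
      have hs : √(α ^ 2 / 2) ^ 2 = α ^ 2 / 2 := Real.sq_sqrt (by positivity)
      calc 1 / √(α ^ 2 / 2) * (2 * (1 / √(α ^ 2 / 2))) = 2 / √(α ^ 2 / 2) ^ 2 := by ring
        _ = 4 / α ^ 2 := by rw [hs]; field_simp; norm_num
    rw [← hval]
    refine (hff'.mul hsq).congr fun s => ?_
    rw [hg, (hf_deriv s).deriv]
    ring
  refine ⟨htop, (htop.comp tendsto_neg_atBot_atTop).congr fun s => ?_⟩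
  simp only [Function.comp_apply, hg, (hf_deriv _).deriv, hf_odd, hϑ_even]
  rw [Odd.neg_pow (by decide), mul_neg, neg_div_neg_eq]
end

section
/- Assume (ϑ1) and (ϑ2), and let q ∈ (3, ∞). Then for every s with |s| ≥ 1 one has g(s)/s ≥ (f(1)^{q+1}/2) |s|^{(q-3)/2}, and consequently lim_{|s|→∞} g(s)/s = +∞. -/
open Filter Topology Set

/-- A solution of `f' = ϑ(f)^{-1/2}` with `f 0 = 0` satisfies `f s ≤ 2 s f' s` for `s > 0`, provided
`ϑ t / t ^ 2` is nonincreasing on `(0, ∞)`. -/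
theorem apply_mul_sqrt_le_two_mul {ϑ f : ℝ → ℝ} (hpos : ∀ s, 0 < ϑ s) (hf_zero : f 0 = 0)
    (hf_mono : StrictMono f) (hf_deriv : ∀ s, HasDerivAt f (1 / Real.sqrt (ϑ (f s))) s)
    (hanti : AntitoneOn (fun s => ϑ s / s ^ 2) (Ioi 0)) {S : ℝ} (hS : 0 < S) :
    f S * Real.sqrt (ϑ (f S)) ≤ 2 * S := by
  have hfpos : ∀ s, 0 < s → 0 < f s := fun s hs => hf_zero ▸ hf_mono hs
  have hT := hfpos S hS
  set c := Real.sqrt (ϑ (f S)) / f S with hc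
  have hd : ∀ s, HasDerivAt (fun s => s - f s ^ 2 * (c / 2))
      (1 - f s * c / Real.sqrt (ϑ (f s))) s := by
    intro s
    have h := (hasDerivAt_id s).sub (((hf_deriv s).pow 2).mul_const (c / 2))
    refine h.congr_deriv ?_
    push_cast
    ring
  have hm : MonotoneOn (fun s => s - f s ^ 2 * (c / 2)) (Icc 0 S) := by
    refine monotoneOn_of_deriv_nonneg (convex_Icc 0 S)
      (fun s _ => (hd s).continuousAt.continuousWithinAt)
      (fun s _ => (hd s).differentiableAt.differentiableWithinAt) ?_
    intro s hs
    rw [interior_Icc] at hs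
    have hfs := hfpos s hs.1
    have hsq := Real.sqrt_pos.2 (hpos (f s))
    rw [(hd s).deriv, sub_nonneg, div_le_one hsq]
    have h1 := Real.sqrt_le_sqrt (hanti hfs hT (hf_mono.monotone hs.2.le))
    rw [Real.sqrt_div' _ (sq_nonneg _), Real.sqrt_div' _ (sq_nonneg _), Real.sqrt_sq hfs.le,
      Real.sqrt_sq hT.le, ← hc, le_div_iff₀ hfs] at h1
    linarith
  have h := hm (left_mem_Icc.2 hS.le) (right_mem_Icc.2 hS.le) hS.le
  have hcT : f S ^ 2 * (c / 2) = f S * Real.sqrt (ϑ (f S)) / 2 := by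
    rw [hc]
    field_simp
  simp only [hf_zero, hcT] at h
  linarith

/-- If `f s ≤ 2 s f' s` for `s > 0` and `f` is positive there, then `f s ^ 2 / s` is nondecreasing. -/
theorem sq_div_self_monotoneOn {f f' : ℝ → ℝ} (hf : ∀ s, HasDerivAt f (f' s) s)
    (hfpos : ∀ s, 0 < s → 0 < f s) (hle : ∀ s, 0 < s → f s ≤ 2 * s * f' s) :
    MonotoneOn (fun s => f s ^ 2 / s) (Ioi 0) := by
  have hd : ∀ s, 0 < s → HasDerivAt (fun s => f s ^ 2 / s)
      (f s * (2 * s * f' s - f s) / s ^ 2) s := by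
    intro s hs
    refine (((hf s).pow 2).div (hasDerivAt_id s) hs.ne').congr_deriv ?_
    simp only [id, Pi.pow_apply]
    push_cast
    ring
  refine monotoneOn_of_deriv_nonneg (convex_Ioi 0)
    (fun s hs => (hd s hs).continuousAt.continuousWithinAt)
    (fun s hs => (hd s (interior_subset hs)).differentiableAt.differentiableWithinAt) ?_
  intro s hs
  have hs : 0 < s := interior_subset hs
  rw [(hd s hs).deriv]
  have := sub_nonneg.2 (hle s hs)
  have := hfpos s hs
  positivity

/-- Under (ϑ1)-(ϑ2) and q ∈ (3,∞): g(s)/s ≥ (f(1)^{q+1}/2)|s|^{(q-3)/2} for |s| ≥ 1, hence lim_{|s|→∞} g(s)/s = +∞. -/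
theorem stmt_16
    (ϑ f : ℝ → ℝ)
    (hϑ_even : ∀ s, ϑ (-s) = ϑ s)
    (hϑ_C1 : ContDiff ℝ 1 ϑ)
    (hϑ_ge1 : ∀ s, 1 ≤ ϑ s)
    (hf_odd : ∀ s, f (-s) = - f s)
    (hf_zero : f 0 = 0)
    (hf_C2 : ContDiff ℝ 2 f)
    (hf_mono : StrictMono f)
    (hf_surj : Function.Surjective f)
    (hf_deriv : ∀ s, HasDerivAt f (1 / Real.sqrt (ϑ (f s))) s)
    (hϑ1_dec : StrictAntiOn ϑ (Set.Iio 0))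
    (hϑ1_inc : StrictMonoOn ϑ (Set.Ioi 0))
    (hϑ2_neg : MonotoneOn (fun s => ϑ s / s ^ 2) (Set.Iio 0))
    (hϑ2_pos : AntitoneOn (fun s => ϑ s / s ^ 2) (Set.Ioi 0))
    (q : ℝ) (g : ℝ → ℝ)
    (hg : ∀ s, g s = deriv f s * |f s| ^ (q - 1) * f s)
    (hq : 3 < q) :
    (∀ s : ℝ, 1 ≤ |s| → f 1 ^ (q + 1) / 2 * |s| ^ ((q - 3) / 2) ≤ g s / s) ∧
    Tendsto (fun s => g s / s) atTop atTop ∧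
    Tendsto (fun s => g s / s) atBot atTop := by
  have hpos : ∀ s, 0 < ϑ s := fun s => zero_lt_one.trans_le (hϑ_ge1 s)
  have hfpos : ∀ s, 0 < s → 0 < f s := fun s hs => hf_zero ▸ hf_mono hs
  have hle : ∀ s, 0 < s → f s ≤ 2 * s * (1 / Real.sqrt (ϑ (f s))) := by
    intro s hs
    rw [mul_one_div, le_div_iff₀ (Real.sqrt_pos.2 (hpos _))]
    exact apply_mul_sqrt_le_two_mul hpos hf_zero hf_mono hf_deriv hϑ2_pos hs
  have hmono := sq_div_self_monotoneOn hf_deriv hfpos hle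
  have h1 := hfpos 1 one_pos
  have hbound : ∀ s : ℝ, 1 ≤ s → f 1 ^ (q + 1) / 2 * s ^ ((q - 3) / 2) ≤ g s / s := by
    intro s hs
    have hs0 : 0 < s := zero_lt_one.trans_le hs
    have hfs := hfpos s hs0
    have hsq : f 1 ^ 2 * s ≤ f s ^ 2 := by
      have h := hmono (mem_Ioi.2 one_pos) hs0 hs
      simp only [div_one] at h
      rwa [le_div_iff₀ hs0] at h
    have hpow : f 1 ^ (q + 1) * s ^ ((q + 1) / 2) ≤ f s ^ (q + 1) := by
      have h := Real.rpow_le_rpow (by positivity) hsq (by linarith : 0 ≤ (q + 1) / 2)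
      rw [Real.mul_rpow (by positivity) hs0.le, ← Real.rpow_natCast_mul h1.le,
        ← Real.rpow_natCast_mul hfs.le] at h
      have e : ((2 : ℕ) : ℝ) * ((q + 1) / 2) = q + 1 := by push_cast; ring
      rwa [e] at h
    have hexp : s ^ ((q + 1) / 2) = s ^ ((q - 3) / 2) * s ^ 2 := by
      rw [← Real.rpow_natCast s 2, ← Real.rpow_add hs0]
      congr 1
      push_cast
      ring
    have hfq : f s ^ (q + 1) = f s ^ (q - 1) * f s * f s := by
      rw [mul_assoc, ← sq, ← Real.rpow_natCast (f s) 2, ← Real.rpow_add hfs]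
      congr 1
      push_cast
      ring
    rw [hexp, hfq] at hpow
    rw [hg, (hf_deriv s).deriv, abs_of_pos hfs, le_div_iff₀ hs0]
    have h2 := mul_le_mul_of_nonneg_left (hle s hs0)
      (by positivity : 0 ≤ f s ^ (q - 1) * f s)
    refine le_of_mul_le_mul_right ?_ (by positivity : 0 < 2 * s)
    linarith
  have heven : ∀ s, g (-s) / (-s) = g s / s := by
    intro s
    rw [hg, hg, (hf_deriv s).deriv, (hf_deriv (-s)).deriv, hf_odd, hϑ_even, abs_neg, mul_neg,
      neg_div_neg_eq]
  have htop : Tendsto (fun s => g s / s) atTop atTop := by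
    refine tendsto_atTop_mono' atTop ((eventually_ge_atTop 1).mono hbound) ?_
    exact (tendsto_rpow_atTop (by linarith)).const_mul_atTop (by positivity)
  refine ⟨fun s hs => ?_, htop, ?_⟩
  · have h := hbound |s| hs
    rcases abs_choice s with e | e
    · rwa [e] at h ⊢
    · rw [e] at h ⊢
      rwa [heven] at h
  · simpa only [Function.comp_def, heven] using htop.comp tendsto_neg_atBot_atTop
end

section
/- Assume (ϑ1) and (ϑ2), and let q ∈ (0, 1]. Then the map s ↦ g(s)/s is strictly decreasing on (0, ∞) (and, since g is odd, s ↦ g(s)/s is strictly decreasing with respect to |s|, i.e. strictly increasing on (-∞, 0)). -/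
open Filter Topology Set

/-- If `f 0 = 0` and `f` has derivative `f'` which is antitone on `(0, ∞)`, then `f s / s` is
antitone on `(0, ∞)`. -/
theorem antitoneOn_div_self_of_hasDerivAt {f f' : ℝ → ℝ} (hf0 : f 0 = 0)
    (hf : ∀ s, HasDerivAt f (f' s) s) (hf' : AntitoneOn f' (Set.Ioi 0)) :
    AntitoneOn (fun s => f s / s) (Set.Ioi 0) := by
  intro s hs t ht hst
  have hs' : 0 < s := hs
  have hcont : Continuous f := continuous_iff_continuousAt.2 fun x => (hf x).continuousAt
  rcases hst.eq_or_lt with rfl | hlt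
  · rfl
  obtain ⟨c, hc, hcs⟩ := exists_hasDerivAt_eq_slope f f' hs' hcont.continuousOn fun x _ => hf x
  obtain ⟨d, hd, hds⟩ := exists_hasDerivAt_eq_slope f f' hlt hcont.continuousOn fun x _ => hf x
  have hdc : f' d ≤ f' c :=
    hf' hc.1 (hs'.trans hd.1) (hc.2.trans hd.1).le
  rw [hcs, hds, hf0, sub_zero, sub_zero, div_le_div_iff₀ (sub_pos.2 hlt) hs'] at hdc
  change f t / t ≤ f s / s
  rw [div_le_div_iff₀ ht hs']
  linarith

/-- Under (ϑ1)-(ϑ2) and q ∈ (0,1], the map s ↦ g(s)/s is strictly decreasing on (0,∞) and (g being odd) strictly increasing on (-∞,0). -/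
theorem stmt_17
    (ϑ f : ℝ → ℝ)
    (hϑ_even : ∀ s, ϑ (-s) = ϑ s)
    (hϑ_C1 : ContDiff ℝ 1 ϑ)
    (hϑ_ge1 : ∀ s, 1 ≤ ϑ s)
    (hf_odd : ∀ s, f (-s) = - f s)
    (hf_zero : f 0 = 0)
    (hf_C2 : ContDiff ℝ 2 f)
    (hf_mono : StrictMono f)
    (hf_surj : Function.Surjective f)
    (hf_deriv : ∀ s, HasDerivAt f (1 / Real.sqrt (ϑ (f s))) s)
    (hϑ1_dec : StrictAntiOn ϑ (Set.Iio 0))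
    (hϑ1_inc : StrictMonoOn ϑ (Set.Ioi 0))
    (hϑ2_neg : MonotoneOn (fun s => ϑ s / s ^ 2) (Set.Iio 0))
    (hϑ2_pos : AntitoneOn (fun s => ϑ s / s ^ 2) (Set.Ioi 0))
    (q : ℝ) (g : ℝ → ℝ)
    (hg : ∀ s, g s = deriv f s * |f s| ^ (q - 1) * f s)
    (hq0 : 0 < q) (hq1 : q ≤ 1) :
    StrictAntiOn (fun s => g s / s) (Set.Ioi 0) ∧
    StrictMonoOn (fun s => g s / s) (Set.Iio 0) := by
  have hpos : ∀ s, 0 < s → 0 < f s := fun s hs => hf_zero ▸ hf_mono hs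
  have hderiv_anti : StrictAntiOn (fun s => 1 / Real.sqrt (ϑ (f s))) (Set.Ioi 0) := by
    intro s hs t ht hst
    have h1 : 0 < ϑ (f s) := one_pos.trans_le (hϑ_ge1 _)
    exact one_div_lt_one_div_of_lt (Real.sqrt_pos.2 h1)
      (Real.sqrt_lt_sqrt h1.le (hϑ1_inc (hpos s hs) (hpos t ht) (hf_mono hst)))
  have hdiv := antitoneOn_div_self_of_hasDerivAt hf_zero hf_deriv hderiv_anti.antitoneOn
  have hanti : StrictAntiOn (fun s => g s / s) (Set.Ioi 0) := by
    intro s hs t ht hst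
    have hfs := hpos s hs
    have hft := hpos t ht
    have hd : 1 / Real.sqrt (ϑ (f t)) < 1 / Real.sqrt (ϑ (f s)) := hderiv_anti hs ht hst
    have hpow : f t ^ (q - 1) ≤ f s ^ (q - 1) :=
      Real.rpow_le_rpow_of_nonpos hfs (hf_mono hst).le (by linarith)
    have hq : f t / t ≤ f s / s := hdiv hs ht hst.le
    change g t / t < g s / s
    rw [hg, hg, (hf_deriv s).deriv, (hf_deriv t).deriv, abs_of_pos hfs, abs_of_pos hft,
      mul_div_assoc, mul_div_assoc, mul_assoc, mul_assoc]
    have ht' : 0 < t := ht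
    have hs' : 0 < s := hs
    exact mul_lt_mul hd (mul_le_mul hpow hq (by positivity) (by positivity)) (by positivity)
      (by positivity)
  have heven : ∀ s, g (-s) / (-s) = g s / s := by
    intro s
    rw [hg, hg, (hf_deriv s).deriv, (hf_deriv (-s)).deriv, hf_odd, hϑ_even, abs_neg, mul_neg,
      neg_div_neg_eq]
  refine ⟨hanti, fun s hs t ht hst => ?_⟩
  have h := hanti (Set.mem_Ioi.2 (neg_pos.2 ht)) (Set.mem_Ioi.2 (neg_pos.2 hs)) (neg_lt_neg hst)
  simpa only [heven] using h
end

section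
/- Assume (ϑ2), and let q ∈ [3, ∞). Then the map s ↦ g(s)/s is strictly increasing on (0, ∞) (and, since g is odd, s ↦ g(s)/s is strictly increasing with respect to |s|, i.e. strictly decreasing on (-∞, 0)). -/
open Filter Topology Set

/-- If an increasing surjection `f` vanishes at `0`, has derivative in `(0, 1]`, and `f f'` is
monotone on `(0, ∞)`, then `s ↦ f s ^ 2 / s` is strictly increasing on `(0, ∞)`. -/
theorem strictMonoOn_sq_div_of_monotoneOn_mul_deriv {f f' : ℝ → ℝ} (hf_zero : f 0 = 0)
    (hf_mono : StrictMono f) (hf_surj : Function.Surjective f)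
    (hf_deriv : ∀ s, HasDerivAt f (f' s) s) (hf'_pos : ∀ s, 0 < f' s) (hf'_le : ∀ s, f' s ≤ 1)
    (hw : MonotoneOn (fun s => f s * f' s) (Ioi 0)) :
    StrictMonoOn (fun s => f s ^ 2 / s) (Ioi 0) := by
  have hpos : ∀ s, 0 < s → 0 < f s := fun s hs => hf_zero ▸ hf_mono hs
  have hd : ∀ s, HasDerivAt (fun s => f s ^ 2) (2 * (f s * f' s)) s := fun s =>
    ((hf_deriv s).fun_pow 2).congr_deriv (by push_cast; ring)
  have hcont : Continuous fun s => f s ^ 2 :=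
    continuous_iff_continuousAt.2 fun s => (hd s).continuousAt
  have mvt : ∀ a b, a < b → ∃ c ∈ Ioo a b, 2 * (f c * f' c) * (b - a) = f b ^ 2 - f a ^ 2 := by
    intro a b hab
    obtain ⟨c, hc, h⟩ := exists_hasDerivAt_eq_slope (fun s => f s ^ 2) _ hab hcont.continuousOn
      fun x _ => hd x
    exact ⟨c, hc, by rw [h, div_mul_cancel₀ _ (sub_pos.2 hab).ne']⟩
  have upper : ∀ a b, 0 ≤ a → a < b → f b ^ 2 - f a ^ 2 ≤ 2 * (f b * f' b) * (b - a) := by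
    intro a b ha hab
    obtain ⟨c, hc, h⟩ := mvt a b hab
    have := hw (mem_Ioi.2 (ha.trans_lt hc.1)) (mem_Ioi.2 (ha.trans_lt hab)) hc.2.le
    simp only at this
    rw [← h]
    have := sub_pos.2 hab
    gcongr
  have lower : ∀ a b, 0 < a → a < b → 2 * (f a * f' a) * (b - a) ≤ f b ^ 2 - f a ^ 2 := by
    intro a b ha hab
    obtain ⟨c, hc, h⟩ := mvt a b hab
    have := hw (mem_Ioi.2 ha) (mem_Ioi.2 (ha.trans hc.1)) hc.1.le
    simp only at this
    rw [← h]
    have := sub_pos.2 hab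
    gcongr
  have key : ∀ a, 0 < a → f a ^ 2 < 2 * (f a * f' a) * a := by
    intro a ha
    have hwa : 0 < f a * f' a := mul_pos (hpos a ha) (hf'_pos a)
    have hwle : f a * f' a ≤ f a := mul_le_of_le_one_right (hpos a ha).le (hf'_le a)
    obtain ⟨c, hc⟩ := hf_surj (f a * f' a / 2)
    have hc0 : 0 < c := hf_mono.lt_iff_lt.1 (by rw [hf_zero, hc]; linarith)
    have hca : c < a := hf_mono.lt_iff_lt.1 (by rw [hc]; linarith)
    have hwc : f c * f' c ≤ f c := mul_le_of_le_one_right (hpos c hc0).le (hf'_le c)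
    have h1 := upper 0 c le_rfl hc0
    have h2 := upper c a hc0.le hca
    rw [hf_zero] at h1
    have h3 : f c * f' c * c < f a * f' a * c := mul_lt_mul_of_pos_right (by linarith) hc0
    linarith
  intro a ha b hb hab
  simp only [mem_Ioi] at ha hb
  simp only
  rw [div_lt_div_iff₀ ha hb]
  have h1 := mul_lt_mul_of_pos_right (key a ha) (sub_pos.2 hab)
  have h2 := mul_le_mul_of_nonneg_right (lower a b ha hab) ha.le
  linarith

/-- Under (ϑ2) and q ∈ [3,∞), the map s ↦ g(s)/s is strictly increasing on (0,∞) and (g being odd) strictly decreasing on (-∞,0). -/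
theorem stmt_18
    (ϑ f : ℝ → ℝ)
    (hϑ_even : ∀ s, ϑ (-s) = ϑ s)
    (hϑ_C1 : ContDiff ℝ 1 ϑ)
    (hϑ_ge1 : ∀ s, 1 ≤ ϑ s)
    (hf_odd : ∀ s, f (-s) = - f s)
    (hf_zero : f 0 = 0)
    (hf_C2 : ContDiff ℝ 2 f)
    (hf_mono : StrictMono f)
    (hf_surj : Function.Surjective f)
    (hf_deriv : ∀ s, HasDerivAt f (1 / Real.sqrt (ϑ (f s))) s)
    (hϑ2_neg : MonotoneOn (fun s => ϑ s / s ^ 2) (Set.Iio 0))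
    (hϑ2_pos : AntitoneOn (fun s => ϑ s / s ^ 2) (Set.Ioi 0))
    (q : ℝ) (g : ℝ → ℝ)
    (hg : ∀ s, g s = deriv f s * |f s| ^ (q - 1) * f s)
    (hq : 3 ≤ q) :
    StrictMonoOn (fun s => g s / s) (Set.Ioi 0) ∧
    StrictAntiOn (fun s => g s / s) (Set.Iio 0) := by
  have hpos : ∀ s, 0 < s → 0 < f s := fun s hs => hf_zero ▸ hf_mono hs
  have hsqrt : ∀ s, 1 ≤ √(ϑ s) := fun s => Real.one_le_sqrt.2 (hϑ_ge1 s)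
  have hw : MonotoneOn (fun s => f s * (1 / √(ϑ (f s)))) (Ioi 0) := by
    intro a ha b hb hab
    have hfa := hpos a ha
    have hfb := hpos b hb
    have h := hϑ2_pos (mem_Ioi.2 hfa) (mem_Ioi.2 hfb) (hf_mono.monotone hab)
    have h' := Real.sqrt_le_sqrt h
    simp only at h'
    rw [Real.sqrt_div' _ (sq_nonneg _), Real.sqrt_div' _ (sq_nonneg _), Real.sqrt_sq hfa.le,
      Real.sqrt_sq hfb.le, div_le_div_iff₀ hfb hfa] at h'
    have h1 := hsqrt (f a)
    have h2 := hsqrt (f b)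
    simp only [mul_one_div]
    rw [div_le_div_iff₀ (by linarith) (by linarith)]
    linarith
  have hsq := strictMonoOn_sq_div_of_monotoneOn_mul_deriv hf_zero hf_mono hf_surj hf_deriv
    (fun s => by have := hsqrt (f s); positivity)
    (fun s => div_le_one_of_le₀ (hsqrt (f s)) (Real.sqrt_nonneg _)) hw
  have hfac : ∀ s, 0 < s →
      g s / s = f s * (1 / √(ϑ (f s))) * f s ^ (q - 3) * (f s ^ 2 / s) := by
    intro s hs
    have hfs := hpos s hs
    have hpow : f s ^ (q - 1) = f s ^ (q - 3) * f s ^ 2 := by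
      rw [← Real.rpow_natCast, ← Real.rpow_add hfs]
      congr 1
      push_cast
      ring
    rw [hg, (hf_deriv s).deriv, abs_of_pos hfs, hpow]
    ring
  have hmono : StrictMonoOn (fun s => g s / s) (Ioi 0) := by
    intro a ha b hb hab
    have hfa := hpos a ha
    have hfb := hpos b hb
    have hwa : 0 < f a * (1 / √(ϑ (f a))) := by have := hsqrt (f a); positivity
    have hwab := hw ha hb hab.le
    have hsqab := hsq ha hb hab
    have hrpow : f a ^ (q - 3) ≤ f b ^ (q - 3) :=
      Real.rpow_le_rpow hfa.le (hf_mono.monotone hab.le) (by linarith)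
    simp only [mem_Ioi] at ha hb hwab hsqab ⊢
    rw [hfac a ha, hfac b hb]
    have hra : 0 < f a ^ (q - 3) := Real.rpow_pos_of_pos hfa _
    exact mul_lt_mul' (mul_le_mul hwab hrpow hra.le (hwa.le.trans hwab)) hsqab (by positivity)
      (mul_pos (hwa.trans_le hwab) (hra.trans_le hrpow))
  have heven : ∀ s, g (-s) / -s = g s / s := by
    intro s
    rw [hg, hg, (hf_deriv (-s)).deriv, (hf_deriv s).deriv, hf_odd, hϑ_even, abs_neg, mul_neg,
      neg_div_neg_eq]
  refine ⟨hmono, fun a ha b hb hab => ?_⟩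
  have h := hmono (mem_Ioi.2 (neg_pos.2 hb)) (mem_Ioi.2 (neg_pos.2 ha)) (neg_lt_neg hab)
  simpa only [heven] using h
end

section
/- Let (X, μ) be a measure space, p ∈ [1, ∞), and let K be a compact subset of the Lebesgue space L^p(X, μ) of real-valued functions such that 0 ∉ K and K is symmetric with respect to the origin (i.e. −v ∈ K whenever v ∈ K). Then there exist β > 0 and s₀ > 0 such that for every s ≥ s₀ and every v ∈ K, the measure of the set {x ∈ X : s·|v(x)| > 1} is at least β. -/
open MeasureTheory ENNReal

/-- A function that is not almost everywhere zero exceeds some `ε > 0` in absolute value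
on a set of positive measure. -/
theorem exists_pos_measure_lt_abs {X : Type*} [MeasurableSpace X] {μ : Measure X} {f : X → ℝ}
    (hf : ¬ f =ᵐ[μ] 0) : ∃ ε : ℝ, 0 < ε ∧ 0 < μ {x | ε < |f x|} := by
  by_contra! h
  refine hf ?_
  have hn : ∀ n : ℕ, ∀ᵐ x ∂μ, |f x| ≤ 1 / ((n : ℝ) + 1) := fun n => by
    have := le_antisymm (h (1 / ((n : ℝ) + 1)) (by positivity)) bot_le
    simpa [ae_iff] using this
  filter_upwards [ae_all_iff.2 hn] with x hx
  by_contra hne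
  obtain ⟨n, hn⟩ := exists_nat_one_div_lt (abs_pos.2 hne)
  exact absurd (hx n) (not_le.2 hn)

/-- Around a nonzero element of `L^p`, superlevel sets at a suitable level have measure
uniformly bounded below. -/
theorem eventually_le_measure_one_lt_mul_abs {X : Type*} [MeasurableSpace X] {μ : Measure X}
    {p : ℝ≥0∞} [Fact (1 ≤ p)] {v : Lp ℝ p μ} (hv : v ≠ 0) :
    ∃ β : ℝ≥0∞, 0 < β ∧ ∃ s : ℝ, 0 < s ∧
      ∀ᶠ u : Lp ℝ p μ in nhds v, β ≤ μ {x | 1 < s * |(u : X → ℝ) x|} := by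
  obtain ⟨ε, hε, hμ⟩ := exists_pos_measure_lt_abs (μ := μ) (f := v)
    fun h => hv ((Lp.eq_zero_iff_ae_eq_zero).2 h)
  obtain ⟨δ, hδ, hδμ⟩ := exists_between hμ
  have hconv : TendstoInMeasure μ (fun u : Lp ℝ p μ => (u : X → ℝ)) (nhds v) v :=
    tendstoInMeasure_of_tendsto_Lp Filter.tendsto_id
  rw [tendstoInMeasure_iff_dist] at hconv
  have hδ2 : 0 < δ / 2 := ENNReal.half_pos hδ.ne'
  refine ⟨δ / 2, hδ2, 2 / ε, by positivity, ?_⟩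
  filter_upwards [(hconv (ε / 2) (by positivity)).eventually_lt_const hδ2] with u hu
  by_contra! hlt
  have hsub : {x | ε < |(v : X → ℝ) x|} ⊆ {x | 1 < 2 / ε * |(u : X → ℝ) x|} ∪
      {x | ε / 2 ≤ dist ((u : X → ℝ) x) ((v : X → ℝ) x)} := by
    intro x hx
    by_contra! hnot
    simp only [Set.mem_union, Set.mem_ofPred_eq, not_or, not_lt, not_le, Real.dist_eq] at hnot hx
    obtain ⟨h₁, h₂⟩ := hnot
    rw [div_mul_eq_mul_div, div_le_one hε] at h₁
    have := abs_sub_abs_le_abs_sub ((v : X → ℝ) x) ((u : X → ℝ) x)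
    rw [abs_sub_comm] at this
    linarith
  have := calc
    δ < μ {x | ε < |(v : X → ℝ) x|} := hδμ
    _ ≤ _ := (measure_mono hsub).trans (measure_union_le _ _)
    _ < δ / 2 + δ / 2 := ENNReal.add_lt_add hlt hu
    _ = δ := ENNReal.add_halves δ
  exact this.false

/-- Let (X, μ) be a measure space, p ∈ [1, ∞), and K a compact subset
of L^p(X, μ) (real-valued) with 0 ∉ K and K symmetric with respect to the origin.
Then there exist β > 0 and s₀ > 0 such that for every s ≥ s₀ and every v ∈ K the
measure of {x : s·|v(x)| > 1} is at least β. -/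
theorem stmt_19
    {X : Type*} [MeasurableSpace X] (μ : Measure X)
    (p : ℝ≥0∞) [Fact (1 ≤ p)] (hp_top : p ≠ ∞)
    (K : Set (Lp ℝ p μ))
    (hK_compact : IsCompact K)
    (hK_zero : (0 : Lp ℝ p μ) ∉ K)
    (hK_symm : ∀ v ∈ K, -v ∈ K) :
    ∃ β : ℝ≥0∞, 0 < β ∧ ∃ s₀ : ℝ, 0 < s₀ ∧
      ∀ s : ℝ, s₀ ≤ s → ∀ v ∈ K, β ≤ μ {x | 1 < s * |(v : X → ℝ) x|} := by
  refine hK_compact.induction_on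
    (p := fun S => ∃ β : ℝ≥0∞, 0 < β ∧ ∃ s₀ : ℝ, 0 < s₀ ∧
      ∀ s : ℝ, s₀ ≤ s → ∀ v ∈ S, β ≤ μ {x | 1 < s * |(v : X → ℝ) x|}) ?_ ?_ ?_ ?_
  · exact ⟨1, one_pos, 1, one_pos, by simp⟩
  · rintro S T hST ⟨β, hβ, s₀, hs₀, h⟩
    exact ⟨β, hβ, s₀, hs₀, fun s hs v hv => h s hs v (hST hv)⟩
  · rintro S T ⟨β₁, hβ₁, s₁, hs₁, h₁⟩ ⟨β₂, hβ₂, s₂, hs₂, h₂⟩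
    refine ⟨min β₁ β₂, lt_min hβ₁ hβ₂, max s₁ s₂, lt_max_of_lt_left hs₁, fun s hs v hv => ?_⟩
    rcases hv with hv | hv
    · exact (min_le_left _ _).trans (h₁ s ((le_max_left _ _).trans hs) v hv)
    · exact (min_le_right _ _).trans (h₂ s ((le_max_right _ _).trans hs) v hv)
  · intro v hv
    obtain ⟨β, hβ, s₀, hs₀, h⟩ :=
      eventually_le_measure_one_lt_mul_abs (v := v) fun h0 => hK_zero (h0 ▸ hv)
    refine ⟨_, mem_nhdsWithin_of_mem_nhds h, β, hβ, s₀, hs₀, fun s hs u hu => ?_⟩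
    refine le_trans hu (measure_mono fun x (hx : 1 < s₀ * _) => ?_)
    exact hx.trans_le (mul_le_mul_of_nonneg_right hs (abs_nonneg _))
end
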